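/- arXiv:1705.00924 — 6 statements merged into one kernel-verified Lean document; each statement's English description precedes it below -/
import Mathlib

section
/- Every finite multiset of positive real numbers (interpreted as circle areas) whose sum is at most π/(3+2√2) can be packed into the closed unit square [0,1]² ⊆ ℝ². (Packing direction of the main square theorem: the critical density for packing circles into a square is π/(3+2√2) ≈ 0.5390.) -/
noncomputable section

abbrev Plane := EuclideanSpace ℝ (Fin 2)

/-- A finite multiset of positive reals `C`, interpreted as circle areas, can be packed
into `S ⊆ ℝ²`: each area `a` gets a center such that the closed disk of radius `√(a/π)`
lies in `S`, and the open disks are pairwise disjoint. -/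
def Packs (C : Multiset ℝ) (S : Set Plane) : Prop :=
  ∃ l : List (ℝ × Plane),
    (↑(l.map Prod.fst) : Multiset ℝ) = C ∧
    (∀ p ∈ l, Metric.closedBall p.2 (Real.sqrt (p.1 / Real.pi)) ⊆ S) ∧
    l.Pairwise fun p q =>
      Disjoint (Metric.ball p.2 (Real.sqrt (p.1 / Real.pi)))
               (Metric.ball q.2 (Real.sqrt (q.1 / Real.pi)))

/-- The closed unit square `[0,1]² ⊆ ℝ²`. -/
def unitSquare : Set Plane := {p | p 0 ∈ Set.Icc (0:ℝ) 1 ∧ p 1 ∈ Set.Icc (0:ℝ) 1}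

/-- The disks with radii `r ∈ C` can be given centers `(x, y)` satisfying `K r x y` such that their
interiors are pairwise disjoint. -/
def PacksUnder (C : Multiset ℝ) (K : ℝ → ℝ → ℝ → Prop) : Prop :=
  ∃ l : List (ℝ × ℝ × ℝ),
    (↑(l.map Prod.fst) : Multiset ℝ) = C ∧
    (∀ p ∈ l, K p.1 p.2.1 p.2.2) ∧
    l.Pairwise fun p q =>
      (p.1 + q.1) ^ 2 ≤ (p.2.1 - q.2.1) ^ 2 + (p.2.2 - q.2.2) ^ 2

/-- The disk of radius `r` about `(x, y)` lies in the isosceles right triangle with vertices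
`(0, 0)`, `(w, 0)` and `(0, w)`. -/
def DiskInTriangle (w r x y : ℝ) : Prop :=
  r ≤ x ∧ r ≤ y ∧ x + y + √2 * r ≤ w

theorem PacksUnder.add {C₁ C₂ : Multiset ℝ} {K₁ K₂ K : ℝ → ℝ → ℝ → Prop}
    (h₁ : PacksUnder C₁ K₁) (h₂ : PacksUnder C₂ K₂) (f g : ℝ × ℝ → ℝ × ℝ)
    (hf : ∀ p q, ((f p).1 - (f q).1) ^ 2 + ((f p).2 - (f q).2) ^ 2
      = (p.1 - q.1) ^ 2 + (p.2 - q.2) ^ 2)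
    (hg : ∀ p q, ((g p).1 - (g q).1) ^ 2 + ((g p).2 - (g q).2) ^ 2
      = (p.1 - q.1) ^ 2 + (p.2 - q.2) ^ 2)
    (hfK : ∀ r ∈ C₁, ∀ p : ℝ × ℝ, K₁ r p.1 p.2 → K r (f p).1 (f p).2)
    (hgK : ∀ r ∈ C₂, ∀ p : ℝ × ℝ, K₂ r p.1 p.2 → K r (g p).1 (g p).2)
    (hsep : ∀ r ∈ C₁, ∀ s ∈ C₂, ∀ p q : ℝ × ℝ, K₁ r p.1 p.2 → K₂ s q.1 q.2 →
      (r + s) ^ 2 ≤ ((f p).1 - (g q).1) ^ 2 + ((f p).2 - (g q).2) ^ 2) :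
    PacksUnder (C₁ + C₂) K := by
  obtain ⟨l₁, rfl, hK₁, hd₁⟩ := h₁
  obtain ⟨l₂, rfl, hK₂, hd₂⟩ := h₂
  refine ⟨l₁.map (fun p => (p.1, f p.2)) ++ l₂.map (fun p => (p.1, g p.2)), ?_, ?_, ?_⟩
  · simp [Function.comp_def]
  · intro p hp
    rcases List.mem_append.1 hp with hp | hp
    · obtain ⟨q, hq, rfl⟩ := List.mem_map.1 hp
      exact hfK q.1 (List.mem_map_of_mem hq) q.2 (hK₁ q hq)
    · obtain ⟨q, hq, rfl⟩ := List.mem_map.1 hp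
      exact hgK q.1 (List.mem_map_of_mem hq) q.2 (hK₂ q hq)
  · refine List.pairwise_append.2 ⟨?_, ?_, ?_⟩
    · refine List.pairwise_map.2 (hd₁.imp fun h => ?_)
      simpa only [hf] using h
    · refine List.pairwise_map.2 (hd₂.imp fun h => ?_)
      simpa only [hg] using h
    · intro a ha b hb
      obtain ⟨p, hp, rfl⟩ := List.mem_map.1 ha
      obtain ⟨q, hq, rfl⟩ := List.mem_map.1 hb
      exact hsep p.1 (List.mem_map_of_mem hp) q.1 (List.mem_map_of_mem hq) p.2 q.2
        (hK₁ p hp) (hK₂ q hq)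

/-- A weighted multiset splits into two parts whose weights differ by at most the weight of any
element of the heavier part. -/
theorem Multiset.exists_balanced_split {α : Type*} [DecidableEq α] (C : Multiset α) (f : α → ℝ)
    (hf : ∀ c ∈ C, 0 < f c) :
    ∃ C₁ C₂ : Multiset α, C₁ + C₂ = C ∧ (C₂.map f).sum ≤ (C₁.map f).sum ∧
      ∀ c ∈ C₁, (C₁.map f).sum - (C₂.map f).sum ≤ f c := by
  have sum_sub : ∀ D ≤ C, ((C - D).map f).sum = (C.map f).sum - (D.map f).sum := by
    intro D hD
    conv_rhs => rw [← add_tsub_cancel_of_le hD]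
    simp
  have sum_nonneg : 0 ≤ (C.map f).sum :=
    Multiset.sum_nonneg (by simpa using fun c hc => (hf c hc).le)
  let S := C.powerset.toFinset.filter fun D => (C.map f).sum ≤ 2 * (D.map f).sum
  have mem_S : ∀ D, D ∈ S ↔ D ≤ C ∧ (C.map f).sum ≤ 2 * (D.map f).sum := by simp [S]
  obtain ⟨D, hD, hmin⟩ := S.exists_min_image (fun D => (D.map f).sum)
    ⟨C, (mem_S C).2 ⟨le_rfl, by linarith⟩⟩
  obtain ⟨hDC, hDs⟩ := (mem_S D).1 hD
  refine ⟨D, C - D, add_tsub_cancel_of_le hDC, ?_, fun c hc => ?_⟩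
  · rw [sum_sub D hDC]; linarith
  · rw [sum_sub D hDC]
    have hE : (D.map f).sum = f c + ((D.erase c).map f).sum := by
      conv_lhs => rw [← Multiset.cons_erase hc]
      simp
    have hEC : D.erase c ≤ C := (Multiset.erase_le c D).trans hDC
    have hc0 := hf c (Multiset.mem_of_le hDC hc)
    by_cases h : (C.map f).sum ≤ 2 * ((D.erase c).map f).sum
    · linarith [hmin _ ((mem_S _).2 ⟨hEC, h⟩)]
    · have hsum := sum_sub _ hEC
      have := hmin (C - D.erase c) ((mem_S _).2 ⟨tsub_le_self, by linarith⟩)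
      linarith

/-- Every nonnegative real is the squared inradius `(3 - 2 * √2) / 2 * w ^ 2` of an isosceles right
triangle with legs `w`. -/
theorem exists_leg {A : ℝ} (hA : 0 ≤ A) : ∃ w : ℝ, 0 ≤ w ∧ (3 - 2 * √2) / 2 * w ^ 2 = A := by
  have h2 : √2 ^ 2 = 2 := Real.sq_sqrt (by norm_num)
  have h : 0 < 3 - 2 * √2 := by nlinarith [Real.sqrt_nonneg 2]
  refine ⟨√(A / ((3 - 2 * √2) / 2)), Real.sqrt_nonneg _, ?_⟩
  rw [Real.sq_sqrt (by positivity)]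
  field_simp

theorem le_radius_of_legs {h w₁ w₂ r : ℝ} (hh : 0 ≤ h) (hr : 0 ≤ r)
    (hw : w₁ ^ 2 + w₂ ^ 2 ≤ 2 * h ^ 2)
    (hd : (3 - 2 * √2) / 2 * w₁ ^ 2 - (3 - 2 * √2) / 2 * w₂ ^ 2 ≤ r ^ 2) :
    w₁ - h ≤ r := by
  have h2 : √2 ^ 2 = 2 := Real.sq_sqrt (by norm_num)
  have hs := Real.sqrt_nonneg 2
  have hk : 0 < 3 - 2 * √2 := by nlinarith
  rcases le_or_gt w₁ h with hle | hlt
  · linarith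
  have hw₁ : w₁ ≤ √2 * h := abs_le_of_sq_le_sq' (by nlinarith [sq_nonneg w₂]) (by positivity) |>.2
  have hlin : w₁ - h ≤ (3 - 2 * √2) * (w₁ + h) := by
    nlinarith [mul_nonneg (show 0 ≤ √2 - 1 by nlinarith) (sub_nonneg.2 hw₁)]
  have hsq : (3 - 2 * √2) * (w₁ ^ 2 - h ^ 2) ≤ r ^ 2 := by
    nlinarith [mul_le_mul_of_nonneg_left hw hk.le]
  have : (w₁ - h) ^ 2 ≤ r ^ 2 := by
    nlinarith [mul_le_mul_of_nonneg_left hlin (sub_nonneg.2 hlt.le)]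
  exact abs_le_of_sq_le_sq' this hr |>.2

/-- A balanced split of the radii `C`, with two isosceles right triangles of legs `w₁` and `w₂`
whose incircles have the areas of the two parts. -/
theorem exists_split_legs (C : Multiset ℝ) (hpos : ∀ r ∈ C, 0 < r) {h : ℝ} (hh : 0 ≤ h)
    (hsum : (C.map (· ^ 2)).sum ≤ (3 - 2 * √2) * h ^ 2) :
    ∃ C₁ C₂ : Multiset ℝ, ∃ w₁ w₂ : ℝ, C₁ + C₂ = C ∧ 0 ≤ w₁ ∧ 0 ≤ w₂ ∧
      (C₁.map (· ^ 2)).sum ≤ (3 - 2 * √2) / 2 * w₁ ^ 2 ∧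
      (C₂.map (· ^ 2)).sum ≤ (3 - 2 * √2) / 2 * w₂ ^ 2 ∧
      w₁ + w₂ ≤ 2 * h ∧ (∀ r ∈ C₁, w₁ - h ≤ r) ∧ (∀ r ∈ C₂, w₂ - h ≤ r) ∧
      (2 ≤ C.card → C₁.card < C.card ∧ C₂.card < C.card) := by
  have h2 : √2 ^ 2 = 2 := Real.sq_sqrt (by norm_num)
  have hk : 0 < 3 - 2 * √2 := by nlinarith [Real.sqrt_nonneg 2]
  obtain ⟨C₁, C₂, rfl, hle, hdiff⟩ :=
    C.exists_balanced_split (· ^ 2) (fun c hc => pow_pos (hpos c hc) 2)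
  have sum_nonneg : ∀ D : Multiset ℝ, 0 ≤ (D.map (· ^ 2)).sum := fun D =>
    Multiset.sum_nonneg (by simpa using fun c _ => sq_nonneg c)
  obtain ⟨w₁, hw₁, hA₁⟩ := exists_leg (sum_nonneg C₁)
  obtain ⟨w₂, hw₂, hA₂⟩ := exists_leg (sum_nonneg C₂)
  rw [Multiset.map_add, Multiset.sum_add, ← hA₁, ← hA₂] at hsum
  rw [← hA₁, ← hA₂] at hle hdiff
  have hw : w₁ ^ 2 + w₂ ^ 2 ≤ 2 * h ^ 2 := by
    refine le_of_mul_le_mul_left ?_ hk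
    linarith
  have hle' : w₂ ^ 2 ≤ w₁ ^ 2 := le_of_mul_le_mul_left hle (by linarith)
  refine ⟨C₁, C₂, w₁, w₂, rfl, hw₁, hw₂, hA₁.ge, hA₂.ge, ?_, fun r hr => ?_, fun r hr => ?_, ?_⟩
  · exact abs_le_of_sq_le_sq' (by nlinarith [sq_nonneg (w₁ - w₂)]) (by positivity) |>.2
  · exact le_radius_of_legs hh (hpos r (by simp [hr])).le hw (hdiff r hr)
  · have := hpos r (by simp [hr])
    have : w₂ ≤ h := abs_le_of_sq_le_sq' (by linarith) hh |>.2
    linarith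
  · intro hcard
    have hC₂ : C₂ ≠ 0 := by
      rintro rfl
      rw [hA₁, hA₂] at hdiff
      rw [add_zero] at hcard hpos
      obtain ⟨a, D, rfl⟩ : ∃ a D, C₁ = a ::ₘ D := by
        obtain ⟨a, ha⟩ := Multiset.card_pos_iff_exists_mem.1 (by omega : 0 < C₁.card)
        exact ⟨a, _, (Multiset.cons_erase ha).symm⟩
      obtain ⟨b, hb⟩ := Multiset.card_pos_iff_exists_mem.1
        (by rw [Multiset.card_cons] at hcard; omega : 0 < D.card)
      have h1 := hdiff a (by simp)
      have h3 := sum_nonneg (D.erase b)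
      have h4 := hpos b (by simp [hb])
      rw [← Multiset.cons_erase hb] at h1
      simp at h1 h3
      nlinarith
    have hC₁ : C₁ ≠ 0 := by
      rintro rfl
      rw [hA₁, hA₂] at hle
      obtain ⟨a, ha⟩ := Multiset.exists_mem_of_ne_zero hC₂
      have h3 := sum_nonneg (C₂.erase a)
      have h4 := hpos a (by simp [ha])
      rw [← Multiset.cons_erase ha] at hle
      simp at hle h3
      nlinarith
    have := Multiset.card_pos.2 hC₁
    have := Multiset.card_pos.2 hC₂
    simp only [Multiset.card_add]
    omega

/-- Disks whose total area is at most that of the incircle pack into an isosceles right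
triangle. -/
theorem packsUnder_diskInTriangle (C : Multiset ℝ) (hpos : ∀ r ∈ C, 0 < r) {w : ℝ} (hw : 0 ≤ w)
    (hsum : (C.map (· ^ 2)).sum ≤ (3 - 2 * √2) / 2 * w ^ 2) :
    PacksUnder C (DiskInTriangle w) := by
  have h2 : √2 ^ 2 = 2 := Real.sq_sqrt (by norm_num)
  have hs := Real.sqrt_nonneg 2
  induction hn : C.card using Nat.strong_induction_on generalizing C w with
  | _ n ih =>
  subst hn
  rcases lt_or_ge C.card 2 with hlt | hge
  · obtain h0 | h1 : C.card = 0 ∨ C.card = 1 := by omega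
    · rw [Multiset.card_eq_zero] at h0
      exact ⟨[], by simp [h0]⟩
    · obtain ⟨r, rfl⟩ := Multiset.card_eq_one.1 h1
      simp only [Multiset.map_singleton, Multiset.sum_singleton] at hsum
      have hr : r ≤ (2 - √2) / 2 * w :=
        abs_le_of_sq_le_sq' (by nlinarith) (mul_nonneg (by nlinarith) hw) |>.2
      refine ⟨[(r, r, r)], by simp, ?_, by simp⟩
      have := mul_le_mul_of_nonneg_left hr (show 0 ≤ 2 + √2 by positivity)
      simp only [List.mem_singleton, forall_eq]
      exact ⟨le_rfl, le_rfl, by nlinarith⟩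
  -- The altitude of the triangle has length `h`; each part goes to one side of it.
  obtain ⟨h, hh, rfl⟩ : ∃ h : ℝ, 0 ≤ h ∧ w = √2 * h :=
    ⟨w / √2, by positivity, by field_simp⟩
  obtain ⟨C₁, C₂, w₁, w₂, rfl, hw₁, hw₂, hA₁, hA₂, hadd, hr₁, hr₂, hcard⟩ :=
    exists_split_legs C hpos hh (by rw [mul_pow, h2] at hsum; linarith)
  obtain ⟨hc₁, hc₂⟩ := hcard hge
  have key : ∀ v r s t : ℝ, v - h ≤ r → DiskInTriangle v r s t →
      r ≤ √2 * h + √2 / 2 * (s - t - v) ∧ r ≤ √2 / 2 * (v - s - t) ∧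
      √2 * h + √2 / 2 * (s - t - v) + √2 / 2 * (v - s - t) + √2 * r ≤ √2 * h := by
    rintro v r s t hvr ⟨hs', ht', hst⟩
    refine ⟨?_, ?_, ?_⟩
    · have := mul_le_mul_of_nonneg_left (show 2 * v - 2 * h + √2 * r ≤ v + s - t by linarith) hs
      nlinarith
    · have := mul_le_mul_of_nonneg_left (show √2 * r ≤ v - s - t by linarith) hs
      nlinarith
    · nlinarith [mul_le_mul_of_nonneg_left ht' hs]
  refine PacksUnder.add
    (ih _ hc₁ C₁ (fun r hr => hpos r (by simp [hr])) hw₁ hA₁ rfl)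
    (ih _ hc₂ C₂ (fun r hr => hpos r (by simp [hr])) hw₂ hA₂ rfl)
    (fun p => (√2 * h + √2 / 2 * (p.1 - p.2 - w₁), √2 / 2 * (w₁ - p.1 - p.2)))
    (fun p => (√2 / 2 * (w₂ - p.1 - p.2), √2 * h + √2 / 2 * (p.1 - p.2 - w₂)))
    ?_ ?_ ?_ ?_ ?_
  · intro p q
    linear_combination (((p.1 - q.1) ^ 2 + (p.2 - q.2) ^ 2) / 2) * h2
  · intro p q
    linear_combination (((p.1 - q.1) ^ 2 + (p.2 - q.2) ^ 2) / 2) * h2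
  · intro r hr p hp
    exact key w₁ r p.1 p.2 (hr₁ r hr) hp
  · intro r hr p hp
    obtain ⟨hx, hy, hxy⟩ := key w₂ r p.1 p.2 (hr₂ r hr) hp
    exact ⟨hy, hx, by linarith⟩
  · rintro r hr s hs' p q ⟨hp, -, -⟩ ⟨hq, -, -⟩
    have hr0 := hpos r (by simp [hr])
    have hs0 := hpos s (by simp [hs'])
    have hle : (r + s) ^ 2 ≤ (2 * h - w₁ - w₂ + p.1 + q.1) ^ 2 :=
      pow_le_pow_left₀ (by positivity) (by linarith) 2
    dsimp only
    linear_combination hle + sq_nonneg (p.2 - q.2)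
      - (((2 * h + p.1 - p.2 - w₁ - w₂ + q.1 + q.2) ^ 2
        + (w₁ - p.1 - p.2 - 2 * h - q.1 + q.2 + w₂) ^ 2) / 4) * h2

/-- The disk of radius `r` about `(x, y)` lies in the unit square. -/
def DiskInUnitSquare (r x y : ℝ) : Prop :=
  r ≤ x ∧ x + r ≤ 1 ∧ r ≤ y ∧ y + r ≤ 1

theorem packsUnder_diskInUnitSquare (C : Multiset ℝ) (hpos : ∀ r ∈ C, 0 < r)
    (hsum : (C.map (· ^ 2)).sum ≤ 3 - 2 * √2) :
    PacksUnder C DiskInUnitSquare := by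
  have h2 : √2 ^ 2 = 2 := Real.sq_sqrt (by norm_num)
  have hs : 1 ≤ √2 := Real.one_le_sqrt.2 (by norm_num)
  obtain ⟨C₁, C₂, w₁, w₂, rfl, hw₁, hw₂, hA₁, hA₂, hadd, hr₁, hr₂, -⟩ :=
    exists_split_legs C hpos zero_le_one (by simpa using hsum)
  have hpos₁ : ∀ r ∈ C₁, 0 < r := fun r hr => hpos r (by simp [hr])
  have hpos₂ : ∀ r ∈ C₂, 0 < r := fun r hr => hpos r (by simp [hr])
  have key : ∀ v r s t : ℝ, 0 < r → v - 1 ≤ r → DiskInTriangle v r s t →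
      DiskInUnitSquare r s t := by
    rintro v r s t hr hvr ⟨hs', ht', hst⟩
    have := mul_le_mul_of_nonneg_right hs hr.le
    exact ⟨hs', by linarith, ht', by linarith⟩
  refine PacksUnder.add
    (packsUnder_diskInTriangle C₁ hpos₁ hw₁ hA₁) (packsUnder_diskInTriangle C₂ hpos₂ hw₂ hA₂)
    id (fun p => (1 - p.1, 1 - p.2)) (fun p q => rfl) (fun p q => by ring) ?_ ?_ ?_
  · intro r hr p hp
    exact key w₁ r p.1 p.2 (hpos₁ r hr) (hr₁ r hr) hp
  · intro r hr p hp
    obtain ⟨h1, h3, h4, h5⟩ := key w₂ r p.1 p.2 (hpos₂ r hr) (hr₂ r hr) hp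
    exact ⟨by linarith, by linarith, by linarith, by linarith⟩
  · rintro r hr s hs' p q ⟨-, -, hp⟩ ⟨-, -, hq⟩
    have hr0 := hpos₁ r hr
    have hs0 := hpos₂ s hs'
    have hle : (√2 * (r + s)) ^ 2 ≤ (2 - p.1 - p.2 - q.1 - q.2) ^ 2 :=
      pow_le_pow_left₀ (by positivity) (by linarith) 2
    rw [mul_pow, h2] at hle
    dsimp only [id]
    nlinarith [sq_nonneg ((p.1 - (1 - q.1)) - (p.2 - (1 - q.2)))]

theorem EuclideanSpace.abs_sub_apply_le_dist {ι : Type*} [Fintype ι] (p q : EuclideanSpace ℝ ι)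
    (i : ι) : |p i - q i| ≤ dist p q := by
  rw [dist_eq_norm]
  simpa using PiLp.norm_apply_le (p - q) i

theorem DiskInUnitSquare.closedBall_subset {r x y : ℝ} (h : DiskInUnitSquare r x y) :
    Metric.closedBall (!₂[x, y] : Plane) r ⊆ unitSquare := by
  obtain ⟨h1, h2, h3, h4⟩ := h
  intro p hp
  have hp' : dist p !₂[x, y] ≤ r := hp
  have hx := abs_le.1 ((EuclideanSpace.abs_sub_apply_le_dist p !₂[x, y] 0).trans hp')
  have hy := abs_le.1 ((EuclideanSpace.abs_sub_apply_le_dist p !₂[x, y] 1).trans hp')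
  simp at hx hy
  exact ⟨⟨by linarith, by linarith⟩, ⟨by linarith, by linarith⟩⟩

theorem disjoint_ball_of_sq_add_le {r s x y x' y' : ℝ}
    (h : (r + s) ^ 2 ≤ (x - x') ^ 2 + (y - y') ^ 2) :
    Disjoint (Metric.ball (!₂[x, y] : Plane) r) (Metric.ball (!₂[x', y'] : Plane) s) := by
  apply Metric.ball_disjoint_ball
  rw [EuclideanSpace.dist_eq]
  refine Real.le_sqrt_of_sq_le ?_
  simpa [Real.dist_eq, sq_abs] using h

/-- Every finite multiset of positive circle areas with sum at most π/(3+2√2)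
can be packed into the closed unit square. -/
theorem circles_pack_into_unit_square (C : Multiset ℝ) (hpos : ∀ c ∈ C, 0 < c)
    (hsum : C.sum ≤ Real.pi / (3 + 2 * Real.sqrt 2)) :
    Packs C unitSquare := by
  have hpi := Real.pi_pos
  have h2 : √2 ^ 2 = 2 := Real.sq_sqrt (by norm_num)
  have hrad : ∀ c ∈ C, Real.pi * √(c / Real.pi) ^ 2 = c := fun c hc => by
    rw [Real.sq_sqrt (div_pos (hpos c hc) hpi).le]
    field_simp
  have hposr : ∀ r ∈ C.map (fun c => √(c / Real.pi)), 0 < r := by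
    intro r hr
    obtain ⟨c, hc, rfl⟩ := Multiset.mem_map.1 hr
    exact Real.sqrt_pos.2 (div_pos (hpos c hc) hpi)
  obtain ⟨l, hl, hK, hd⟩ := packsUnder_diskInUnitSquare (C.map fun c => √(c / Real.pi)) hposr (by
    have hsq : (C.map fun c => √(c / Real.pi)).map (· ^ 2) = C.map (· / Real.pi) := by
      rw [Multiset.map_map]
      exact Multiset.map_congr rfl fun c hc => Real.sq_sqrt (div_pos (hpos c hc) hpi).le
    have hden : 1 / (3 + 2 * √2) = 3 - 2 * √2 := by
      rw [div_eq_iff (by positivity)]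
      linear_combination 4 * h2
    rw [hsq, Multiset.sum_map_div, Multiset.map_id', ← hden, div_le_iff₀ hpi]
    calc C.sum ≤ _ := hsum
      _ = _ := by ring)
  have hrl : ∀ p ∈ l, √(Real.pi * p.1 ^ 2 / Real.pi) = p.1 := by
    intro p hp
    have hmem : p.1 ∈ (↑(l.map Prod.fst) : Multiset ℝ) := List.mem_map_of_mem hp
    rw [mul_div_cancel_left₀ _ hpi.ne', Real.sqrt_sq (hposr _ (hl ▸ hmem)).le]
  refine ⟨l.map fun p => (Real.pi * p.1 ^ 2, !₂[p.2.1, p.2.2]), ?_, ?_, ?_⟩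
  · have := congrArg (Multiset.map fun r => Real.pi * r ^ 2) hl
    rw [Multiset.map_map, Multiset.map_coe, List.map_map] at this
    rw [List.map_map]
    refine this.trans ?_
    exact (Multiset.map_congr rfl hrad).trans (Multiset.map_id' C)
  · intro p hp
    obtain ⟨q, hq, rfl⟩ := List.mem_map.1 hp
    rw [hrl q hq]
    exact (hK q hq).closedBall_subset
  · refine List.pairwise_map.2 (hd.imp_of_mem fun {p q} hp hq h => ?_)
    rw [hrl p hp, hrl q hq]
    exact disjoint_ball_of_sq_add_le h
end
end

section
/- The number 1/(2+√2) is the largest radius r such that there exist two closed disks of radius r, with disjoint interiors, both contained in the closed unit square [0,1]²: two such disks of radius 1/(2+√2) exist, and if two closed disks of equal radius r with disjoint interiors are both contained in [0,1]², then r ≤ 1/(2+√2). (Twincircles of the square.) -/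
noncomputable section

/-- A closed disk lies in the unit square iff its center has distance at least `r` from each side. -/
lemma closedBall_subset_unitSquare_iff {c : Plane} {r : ℝ} (hr : 0 ≤ r) :
    Metric.closedBall c r ⊆ unitSquare ↔ ∀ i, c i ∈ Set.Icc r (1 - r) := by
  constructor
  · intro h i
    have hmem : ∀ t : ℝ, |t| ≤ r → c + EuclideanSpace.single i t ∈ unitSquare := fun t ht =>
      h (by simpa [Metric.mem_closedBall, dist_eq_norm] using ht)
    obtain ⟨hp₀, hp₁⟩ := hmem r (abs_of_nonneg hr).le
    obtain ⟨hn₀, hn₁⟩ := hmem (-r) (by rw [abs_neg, abs_of_nonneg hr])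
    fin_cases i <;> simp at hp₀ hp₁ hn₀ hn₁ ⊢ <;> constructor <;> linarith
  · intro h p hp
    have hcoord : ∀ i, p i ∈ Set.Icc (0 : ℝ) 1 := fun i => by
      have hle : ‖(p - c) i‖ ≤ r :=
        (PiLp.norm_apply_le (p - c) i).trans (mem_closedBall_iff_norm.mp hp)
      rw [PiLp.sub_apply, Real.norm_eq_abs, abs_le] at hle
      obtain ⟨h₁, h₂⟩ := h i
      constructor <;> linarith
    exact ⟨hcoord 0, hcoord 1⟩

/-- Two open disks of equal positive radius are disjoint iff their centers are at least a diameter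
apart. -/
lemma disjoint_ball_iff_sq_le {c₁ c₂ : Plane} {r : ℝ} (hr : 0 < r) :
    Disjoint (Metric.ball c₁ r) (Metric.ball c₂ r) ↔
      (2 * r) ^ 2 ≤ (c₁ 0 - c₂ 0) ^ 2 + (c₁ 1 - c₂ 1) ^ 2 := by
  rw [disjoint_ball_ball_iff hr hr, EuclideanSpace.dist_eq, Real.le_sqrt' (by positivity),
    Fin.sum_univ_two, Real.dist_eq, Real.dist_eq, sq_abs, sq_abs, two_mul]

/-- Twincircles of the square: `1/(2+√2)` is the largest radius `r` such that two closed
disks of radius `r` with disjoint interiors (open disks) fit into the closed unit square. -/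
theorem square_twincircles :
    (∃ c₁ c₂ : Plane,
        Metric.closedBall c₁ (1 / (2 + Real.sqrt 2)) ⊆ unitSquare ∧
        Metric.closedBall c₂ (1 / (2 + Real.sqrt 2)) ⊆ unitSquare ∧
        Disjoint (Metric.ball c₁ (1 / (2 + Real.sqrt 2)))
                 (Metric.ball c₂ (1 / (2 + Real.sqrt 2)))) ∧
    (∀ (r : ℝ) (c₁ c₂ : Plane),
        Metric.closedBall c₁ r ⊆ unitSquare →
        Metric.closedBall c₂ r ⊆ unitSquare →
        Disjoint (Metric.ball c₁ r) (Metric.ball c₂ r) →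
        r ≤ 1 / (2 + Real.sqrt 2)) := by
  have hs : Real.sqrt 2 ^ 2 = 2 := Real.sq_sqrt (by norm_num)
  have hs₀ : 0 < Real.sqrt 2 := by positivity
  constructor
  · set r : ℝ := 1 / (2 + Real.sqrt 2) with hr
    have hr₀ : 0 < r := by positivity
    have hr₁ : 1 - 2 * r = Real.sqrt 2 * r := by
      rw [hr]
      field_simp
      ring
    have hr₂ : r ≤ 1 - r := by nlinarith
    refine ⟨!₂[r, r], !₂[1 - r, 1 - r], ?_, ?_, ?_⟩
    · rw [closedBall_subset_unitSquare_iff hr₀.le]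
      intro i
      fin_cases i <;> simpa using hr₂
    · rw [closedBall_subset_unitSquare_iff hr₀.le]
      intro i
      fin_cases i <;> simpa using hr₂
    · rw [disjoint_ball_iff_sq_le hr₀]
      simp only [Matrix.cons_val_zero, Matrix.cons_val_one]
      have hd : (r - (1 - r)) ^ 2 = 2 * r ^ 2 := by
        rw [← neg_sq, show -(r - (1 - r)) = Real.sqrt 2 * r by linarith, mul_pow, hs]
      rw [hd]
      linarith
  · intro r c₁ c₂ h₁ h₂ hd
    rcases le_or_gt r 0 with hr | hr
    · exact hr.trans (by positivity)
    rw [closedBall_subset_unitSquare_iff hr.le] at h₁ h₂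
    rw [disjoint_ball_iff_sq_le hr] at hd
    have hw : 0 ≤ 1 - 2 * r := by linarith [(h₁ 0).1, (h₁ 0).2]
    have hle : ∀ i, (c₁ i - c₂ i) ^ 2 ≤ (1 - 2 * r) ^ 2 := fun i =>
      sq_le_sq' (by linarith [(h₁ i).1, (h₂ i).2]) (by linarith [(h₁ i).2, (h₂ i).1])
    have hroot : Real.sqrt 2 * r ≤ 1 - 2 * r := by
      refine (pow_le_pow_iff_left₀ (by positivity) hw two_ne_zero).mp ?_
      rw [mul_pow, hs]
      linarith [hle 0, hle 1]
    rw [le_div_iff₀ (by positivity)]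
    linarith
end
end

section
/- For every ε > 0, the multiset consisting of two equal circle areas, each equal to (π/(3+2√2) + ε)/2, cannot be packed into the closed unit square [0,1]². (Tightness of the critical density π/(3+2√2) for squares.) -/
noncomputable section

theorem mem_Icc_of_closedBall_subset_unitSquare {c : Plane} {r : ℝ} (hr : 0 ≤ r)
    (h : Metric.closedBall c r ⊆ unitSquare) (i : Fin 2) : c i ∈ Set.Icc r (1 - r) := by
  have hmem (s : ℝ) (hs : |s| = r) : c i + s ∈ Set.Icc (0 : ℝ) 1 := by
    have hball : c + EuclideanSpace.single i s ∈ Metric.closedBall c r := by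
      simp [hs]
    have hsq := h hball
    fin_cases i
    · simpa using hsq.1
    · simpa using hsq.2
  have hpos := hmem r (abs_of_nonneg hr)
  have hneg := hmem (-r) (by rw [abs_neg, abs_of_nonneg hr])
  exact ⟨by linarith [hneg.1], by linarith [hpos.2]⟩

/-- Two disjoint disks of equal radius `r` in the unit square satisfy `r ≤ 1 / (2 + √2)`. -/
theorem mul_two_add_sqrt_two_le_one {c d : Plane} {r : ℝ} (hr : 0 < r)
    (hc : Metric.closedBall c r ⊆ unitSquare) (hd : Metric.closedBall d r ⊆ unitSquare)
    (hcd : Disjoint (Metric.ball c r) (Metric.ball d r)) : r * (2 + √2) ≤ 1 := by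
  have hdist : r + r ≤ dist c d := (disjoint_ball_ball_iff hr hr).1 hcd
  have hcoord (i : Fin 2) : (c i - d i) ^ 2 ≤ (1 - 2 * r) ^ 2 := by
    obtain ⟨hc₁, hc₂⟩ := mem_Icc_of_closedBall_subset_unitSquare hr.le hc i
    obtain ⟨hd₁, hd₂⟩ := mem_Icc_of_closedBall_subset_unitSquare hr.le hd i
    exact sq_le_sq' (by linarith) (by linarith)
  have hhalf : 0 ≤ 1 - 2 * r := by
    obtain ⟨hc₁, hc₂⟩ := mem_Icc_of_closedBall_subset_unitSquare hr.le hc 0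
    linarith
  have hdist_sq : dist c d ^ 2 = (c 0 - d 0) ^ 2 + (c 1 - d 1) ^ 2 := by
    rw [EuclideanSpace.dist_eq, Real.sq_sqrt (by positivity)]
    simp [Fin.sum_univ_two, Real.dist_eq, sq_abs]
  have hsq : (r + r) ^ 2 ≤ dist c d ^ 2 := pow_le_pow_left₀ (by positivity) hdist 2
  have htwo : √2 ^ 2 = 2 := Real.sq_sqrt (by norm_num)
  have hle : √2 * r ≤ 1 - 2 * r := by
    refine le_of_sq_le_sq ?_ hhalf
    rw [mul_pow, htwo]
    nlinarith [hcoord 0, hcoord 1]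
  linarith

/-- Tightness: for every ε > 0, two equal circles of area (π/(3+2√2)+ε)/2 each
cannot be packed into the closed unit square. -/
theorem circles_unit_square_tight (ε : ℝ) (hε : 0 < ε) :
    ¬ Packs ({(Real.pi / (3 + 2 * Real.sqrt 2) + ε) / 2,
              (Real.pi / (3 + 2 * Real.sqrt 2) + ε) / 2} : Multiset ℝ) unitSquare := by
  set a : ℝ := (Real.pi / (3 + 2 * Real.sqrt 2) + ε) / 2 with ha
  rintro ⟨l, hl, hsub, hdisj⟩
  have hperm : (l.map Prod.fst).Perm (List.replicate 2 a) := Multiset.coe_eq_coe.1 hl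
  rw [List.perm_replicate] at hperm
  obtain ⟨hlen, hfst⟩ := (List.eq_replicate_iff.1 hperm)
  rw [List.length_map, List.length_eq_two] at hlen
  obtain ⟨⟨x, c⟩, ⟨y, d⟩, rfl⟩ := hlen
  obtain rfl : x = a := hfst x (by simp)
  obtain rfl : y = a := hfst y (by simp)
  have hπ := Real.pi_pos
  have hapos : 0 < a / Real.pi := by positivity
  have hr : √(a / Real.pi) * (2 + √2) ≤ 1 :=
    mul_two_add_sqrt_two_le_one (Real.sqrt_pos.2 hapos) (hsub (a, c) (by simp))
      (hsub (a, d) (by simp)) (by simpa using hdisj)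
  have hsq : (√(a / Real.pi) * (2 + √2)) ^ 2 ≤ 1 := pow_le_one₀ (by positivity) hr
  have htwo : (2 + √2) ^ 2 = 2 * (3 + 2 * √2) := by
    linear_combination Real.sq_sqrt (show (0 : ℝ) ≤ 2 by norm_num)
  have harea : a / Real.pi * (2 * (3 + 2 * √2)) = 1 + ε * (3 + 2 * √2) / Real.pi := by
    rw [ha]
    field_simp
  rw [mul_pow, Real.sq_sqrt hapos.le, htwo, harea] at hsq
  have : 0 < ε * (3 + 2 * √2) / Real.pi := by positivity
  linarith
end
end

section
/- For every nonempty finite multiset C of positive real numbers there exist multisets C₁ and C₂ with C₁ + C₂ = C (as multisets), such that the sum of C₁ is at most the sum of C₂, and every element c of C₂ satisfies c ≥ (sum of C₂) − (sum of C₁). (Correctness of the greedy splitting algorithm.) -/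
/-- Correctness of the greedy splitting algorithm: every nonempty finite multiset of
positive reals can be partitioned into `C₁` and `C₂` with `sum C₁ ≤ sum C₂` and every
element of `C₂` at least `sum C₂ − sum C₁`. -/
theorem greedy_split (C : Multiset ℝ) (hne : C ≠ 0) (hpos : ∀ c ∈ C, 0 < c) :
    ∃ C₁ C₂ : Multiset ℝ, C₁ + C₂ = C ∧ C₁.sum ≤ C₂.sum ∧
      ∀ c ∈ C₂, C₂.sum - C₁.sum ≤ c := by
  classical
  -- Take a splitting that minimizes the absolute difference of the two sums.
  obtain ⟨A, hA, hmin⟩ := C.powerset.toFinset.exists_min_image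
    (fun D => |C.sum - 2 * D.sum|) ⟨0, by simp⟩
  simp only [Multiset.mem_toFinset, Multiset.mem_powerset] at hA hmin
  obtain ⟨B, rfl⟩ := Multiset.le_iff_exists_add.mp hA
  have hAB : ∀ X Y : Multiset ℝ, X + Y = A + B → |B.sum - A.sum| ≤ |Y.sum - X.sum| := by
    intro X Y h
    have hX := hmin X (h ▸ Multiset.le_add_right X Y)
    rw [← h, Multiset.sum_add] at hX
    have hs := congrArg Multiset.sum h
    simp only [Multiset.sum_add] at hs
    rwa [hs, show A.sum + B.sum - 2 * A.sum = B.sum - A.sum by ring, ← hs,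
      show X.sum + Y.sum - 2 * X.sum = Y.sum - X.sum by ring] at hX
  have move : ∀ X Y : Multiset ℝ, X + Y = A + B → |Y.sum - X.sum| = |B.sum - A.sum| →
      X.sum ≤ Y.sum → ∀ c ∈ Y, Y.sum - X.sum ≤ c := by
    intro X Y h habs hle c hc
    by_contra! hlt
    have hc0 : 0 < c := hpos c (h ▸ Multiset.mem_add.mpr (Or.inr hc))
    obtain ⟨Z, rfl⟩ := Multiset.exists_cons_of_mem hc
    have hZ := hAB (c ::ₘ X) Z (by rw [← h, Multiset.cons_add, Multiset.add_cons])
    rw [← habs, abs_of_nonneg (sub_nonneg.mpr hle)] at hZ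
    simp only [Multiset.sum_cons] at hZ hlt
    rcases le_abs.mp hZ with h' | h' <;> linarith
  rcases le_total A.sum B.sum with h | h
  · exact ⟨A, B, rfl, h, move A B rfl rfl h⟩
  · exact ⟨B, A, add_comm B A, h, move B A (add_comm B A) (abs_sub_comm _ _) h⟩
end

section
/- For every finite multiset C of positive real numbers and all positive reals f₁, f₂, there exist multisets C₁ and C₂ with C₁ + C₂ = C (as multisets), such that every element c of C₁ satisfies c ≥ (sum of C₁) − f₁·(sum of C₂)/f₂, and every element c of C₂ satisfies c ≥ (sum of C₂) − f₂·(sum of C₁)/f₁. (Correctness of the weighted greedy splitting algorithm with split key (f₁, f₂).) -/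
/-- Division-free form of the splitting theorem, for a list sorted in increasing order: the head
is added last, to the side whose weighted sum is smaller. -/
theorem exists_weighted_split_of_pairwise_le (f₁ f₂ : ℝ) (hf₁ : 0 < f₁) (hf₂ : 0 < f₂)
    (l : List ℝ) (hl : l.Pairwise (· ≤ ·)) (hpos : ∀ c ∈ l, 0 < c) :
    ∃ C₁ C₂ : Multiset ℝ, C₁ + C₂ = (l : Multiset ℝ) ∧
      (∀ c ∈ C₁, f₂ * (C₁.sum - c) ≤ f₁ * C₂.sum) ∧
      (∀ c ∈ C₂, f₁ * (C₂.sum - c) ≤ f₂ * C₁.sum) := by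
  induction l with
  | nil => exact ⟨0, 0, by simp⟩
  | cons x l ih =>
    rw [List.pairwise_cons] at hl
    obtain ⟨C₁, C₂, hC, h₁, h₂⟩ := ih hl.2 fun c hc => hpos c (List.mem_cons_of_mem x hc)
    have hx : 0 < x := hpos x List.mem_cons_self
    have hle : ∀ c ∈ C₁ + C₂, x ≤ c := fun c hc => hl.1 c (by simpa [hC] using hc)
    have hf₁x := mul_pos hf₁ hx
    have hf₂x := mul_pos hf₂ hx
    rcases le_total (f₂ * C₁.sum) (f₁ * C₂.sum) with h | h
    · refine ⟨x ::ₘ C₁, C₂, by simp [hC], fun c hc => ?_, fun c hc => ?_⟩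
      · have hxc : x ≤ c := by
          rcases Multiset.mem_cons.1 hc with rfl | hc
          · exact le_rfl
          · exact hle c (Multiset.mem_add.2 (Or.inl hc))
        have := mul_le_mul_of_nonneg_left hxc hf₂.le
        rw [Multiset.sum_cons]
        linarith
      · have := h₂ c hc
        rw [Multiset.sum_cons]
        linarith
    · refine ⟨C₁, x ::ₘ C₂, by simp [hC], fun c hc => ?_, fun c hc => ?_⟩
      · have := h₁ c hc
        rw [Multiset.sum_cons]
        linarith
      · have hxc : x ≤ c := by
          rcases Multiset.mem_cons.1 hc with rfl | hc
          · exact le_rfl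
          · exact hle c (Multiset.mem_add.2 (Or.inr hc))
        have := mul_le_mul_of_nonneg_left hxc hf₁.le
        rw [Multiset.sum_cons]
        linarith


/-- Correctness of the weighted greedy splitting algorithm with split key `(f₁, f₂)`:
every finite multiset of positive reals can be partitioned into `C₁` and `C₂` such that
every element of `Cᵢ` is at least `sum Cᵢ − fᵢ · (sum Cⱼ)/fⱼ`. -/
theorem weighted_greedy_split (C : Multiset ℝ) (hpos : ∀ c ∈ C, 0 < c)
    (f₁ f₂ : ℝ) (hf₁ : 0 < f₁) (hf₂ : 0 < f₂) :
    ∃ C₁ C₂ : Multiset ℝ, C₁ + C₂ = C ∧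
      (∀ c ∈ C₁, C₁.sum - f₁ * C₂.sum / f₂ ≤ c) ∧
      (∀ c ∈ C₂, C₂.sum - f₂ * C₁.sum / f₁ ≤ c) := by
  obtain ⟨C₁, C₂, hC, h₁, h₂⟩ := exists_weighted_split_of_pairwise_le f₁ f₂ hf₁ hf₂
    (C.sort (· ≤ ·)) (C.pairwise_sort (· ≤ ·))
    fun c hc => hpos c ((Multiset.mem_sort (· ≤ ·)).1 hc)
  refine ⟨C₁, C₂, hC.trans (C.sort_eq (· ≤ ·)), fun c hc => ?_, fun c hc => ?_⟩
  · rw [sub_le_comm, le_div_iff₀ hf₂, mul_comm]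
    exact h₁ c hc
  · rw [sub_le_comm, le_div_iff₀ hf₁, mul_comm]
    exact h₂ c hc
end

section
/- (Split Packing theorem.) Let 0 ≤ b ≤ a and let S ⊆ ℝ². Suppose that for all reals a₁, a₂ with 0 ≤ a₁ ≤ a₂ and a₁ + a₂ ≤ a, there exist subsets S₁, S₂ ⊆ S with disjoint interiors such that S₁ is a 𝔺(a₁, b)-shape and S₂ is a 𝔺(a₂, max(a₂−a₁, b))-shape. Then S is a 𝔺(a, b)-shape. -/
noncomputable section

/-- `S` is a `𝔺(a,b)`-shape: every finite multiset of positive reals with sum at most `a`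
and every element at least `b` can be packed into `S`. -/
def IsCShape (a b : ℝ) (S : Set Plane) : Prop :=
  ∀ C : Multiset ℝ, (∀ c ∈ C, 0 < c) → C.sum ≤ a → (∀ c ∈ C, b ≤ c) → Packs C S

theorem Packs.add {A B : Multiset ℝ} {S S₁ S₂ : Set Plane} (h₁ : S₁ ⊆ S) (h₂ : S₂ ⊆ S)
    (hd : Disjoint (interior S₁) (interior S₂)) (hA : Packs A S₁) (hB : Packs B S₂) :
    Packs (A + B) S := by
  obtain ⟨l, hl, hlS, hlp⟩ := hA
  obtain ⟨m, hm, hmS, hmp⟩ := hB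
  refine ⟨l ++ m, ?_, ?_, ?_⟩
  · rw [List.map_append, ← Multiset.coe_add, hl, hm]
  · intro p hp
    rcases List.mem_append.1 hp with hp | hp
    · exact (hlS p hp).trans h₁
    · exact (hmS p hp).trans h₂
  · refine List.pairwise_append.2 ⟨hlp, hmp, fun p hp q hq => hd.mono ?_ ?_⟩
    · exact interior_maximal (Metric.ball_subset_closedBall.trans (hlS p hp)) Metric.isOpen_ball
    · exact interior_maximal (Metric.ball_subset_closedBall.trans (hmS q hq)) Metric.isOpen_ball

/-- A split into two parts with the smallest possible difference of sums is such that every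
element of the larger part is at least this difference. -/
theorem Multiset.exists_add_eq_sum_sub_sum_le (C : Multiset ℝ) (hC : ∀ c ∈ C, 0 < c) :
    ∃ A B : Multiset ℝ, A + B = C ∧ A.sum ≤ B.sum ∧ ∀ c ∈ B, B.sum - A.sum ≤ c := by
  obtain ⟨⟨A, B⟩, hAB, hmin⟩ := C.antidiagonal.toFinset.exists_min_image
    (fun p => |p.2.sum - p.1.sum|) ⟨(0, C), by simp⟩
  simp only [Multiset.mem_toFinset, Multiset.mem_antidiagonal, Prod.forall] at hAB hmin
  wlog hle : A.sum ≤ B.sum generalizing A B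
  · refine this B A ?_ ?_ (le_of_not_ge hle)
    · rw [add_comm, hAB]
    · simpa only [abs_sub_comm] using hmin
  refine ⟨A, B, hAB, hle, fun c hc => ?_⟩
  by_contra! hlt
  have hpos : 0 < c := hC c (hAB ▸ Multiset.mem_add.2 (Or.inr hc))
  obtain ⟨D, rfl⟩ := Multiset.exists_cons_of_mem hc
  have hmove := hmin (c ::ₘ A) D (by rw [← hAB, Multiset.cons_add, Multiset.add_cons])
  simp only [Multiset.sum_cons] at hmove hlt hle
  rw [abs_of_nonneg (sub_nonneg.2 hle)] at hmove
  exact hmove.not_gt (abs_lt.2 ⟨by linarith, by linarith⟩)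

/-- The Split Packing theorem. -/
theorem split_packing (a b : ℝ) (hb : 0 ≤ b) (hba : b ≤ a) (S : Set Plane)
    (h : ∀ a₁ a₂ : ℝ, 0 ≤ a₁ → a₁ ≤ a₂ → a₁ + a₂ ≤ a →
      ∃ S₁ S₂ : Set Plane, S₁ ⊆ S ∧ S₂ ⊆ S ∧
        Disjoint (interior S₁) (interior S₂) ∧
        IsCShape a₁ b S₁ ∧ IsCShape a₂ (max (a₂ - a₁) b) S₂) :
    IsCShape a b S := by
  intro C hpos hsum hge
  obtain ⟨A, B, rfl, hle, hB⟩ := C.exists_add_eq_sum_sub_sum_le hpos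
  simp only [Multiset.mem_add, or_imp, forall_and] at hpos hge
  rw [Multiset.sum_add] at hsum
  obtain ⟨S₁, S₂, h₁, h₂, hd, hS₁, hS₂⟩ := h A.sum B.sum
    (Multiset.sum_nonneg fun c hc => (hpos.1 c hc).le) hle hsum
  exact (hS₁ A hpos.1 le_rfl hge.1).add h₁ h₂ hd
    (hS₂ B hpos.2 le_rfl fun c hc => max_le (hB c hc) (hge.2 c hc))
end
end
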